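/- arXiv:1301.0859 — 11 statements merged into one kernel-verified Lean document; each statement's English description precedes it below -/
import Mathlib

section
/- Let a > 0 and 0 < g ≤ h. If s, t > 0 satisfy 2^{a/s}/(g s²) = 2^{a/t}/(h t²), then s ≥ t and t ≥ s·√(g/h). -/
/-- Consequence of the first-order optimality condition for power-optimal TDMA:
if `2^(a/s)/(g s²) = 2^(a/t)/(h t²)` with `0 < g ≤ h` and `a, s, t > 0`, then the device
with the smaller gain gets the longer time, `s ≥ t`, and moreover `t ≥ s √(g/h)`. -/
theorem tdma_power_optimality_condition (a g h s t : ℝ)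
    (ha : 0 < a) (hg : 0 < g) (hgh : g ≤ h) (hs : 0 < s) (ht : 0 < t)
    (heq : (2 : ℝ) ^ (a / s) / (g * s ^ 2) = (2 : ℝ) ^ (a / t) / (h * t ^ 2)) :
    t ≤ s ∧ s * Real.sqrt (g / h) ≤ t := by
  have hh : 0 < h := hg.trans_le hgh
  rw [div_eq_div_iff (by positivity) (by positivity)] at heq
  have hpow_s : (0 : ℝ) < 2 ^ (a / s) := by positivity
  have hts : t ≤ s := by
    by_contra! hst
    have hpow : (2 : ℝ) ^ (a / t) < 2 ^ (a / s) :=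
      Real.rpow_lt_rpow_of_exponent_lt one_lt_two (div_lt_div_of_pos_left ha hs hst)
    have hgain : g * s ^ 2 ≤ h * t ^ 2 := by gcongr
    have hlt : (2 : ℝ) ^ (a / t) * (g * s ^ 2) < 2 ^ (a / s) * (h * t ^ 2) :=
      mul_lt_mul hpow hgain (by positivity) hpow_s.le
    exact hlt.ne' heq
  refine ⟨hts, ?_⟩
  have hpow : (2 : ℝ) ^ (a / s) ≤ 2 ^ (a / t) :=
    Real.rpow_le_rpow_of_exponent_le one_le_two (div_le_div_of_nonneg_left ha.le ht hts)
  have hgain : g * s ^ 2 ≤ h * t ^ 2 := by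
    refine le_of_mul_le_mul_left ?_ hpow_s
    rw [heq]
    gcongr
  refine abs_le_of_sq_le_sq' ?_ ht.le |>.2
  rw [mul_pow, Real.sq_sqrt (by positivity), ← mul_div_assoc, div_le_iff₀ hh]
  linarith
end

section
/- Let K ≥ 1 be an integer, 0 < g_1 ≤ g_2 ≤ … ≤ g_K, and L, W, τ_s, μ > 0. If τ* = (τ_1*, …, τ_K*) with τ_i* > 0 and Σ_{i=1}^K τ_i* = τ_s minimizes the total transmit power P(τ) = Σ_{i=1}^K (2^{L/(W τ_i)} − 1)/(μ g_i) over all such schedules, then τ_1* ≤ τ_s / (Σ_{j=1}^K √(g_1/g_j)). -/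
/-- At an interior minimizer of a separable sum under a budget constraint, all marginal values
agree. -/
theorem marginal_eq_of_separable_min {ι : Type*} [Fintype ι] {f : ι → ℝ → ℝ} {f' x : ι → ℝ}
    (hf : ∀ i, HasDerivAt (f i) (f' i) (x i)) (hx : ∀ i, 0 < x i)
    (hmin : ∀ y : ι → ℝ, (∀ i, 0 < y i) → ∑ i, y i = ∑ i, x i →
      ∑ i, f i (x i) ≤ ∑ i, f i (y i)) (i j : ι) : f' i = f' j := by
  classical
  let d : ι → ℝ := Pi.single i 1 - Pi.single j 1
  have hline : ∀ k, HasDerivAt (fun t : ℝ => x k + t * d k) (d k) 0 := fun k => by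
    simpa using ((hasDerivAt_id (0 : ℝ)).mul_const (d k)).const_add (x k)
  have hderiv : HasDerivAt (fun t : ℝ => ∑ k, f k (x k + t * d k)) (∑ k, f' k * d k) 0 :=
    HasDerivAt.fun_sum fun k _ =>
      HasDerivAt.comp (h₂ := f k) 0 (by simpa using hf k) (hline k)
  have hd : ∑ k, d k = 0 := by simp [d]
  have hpos : ∀ᶠ t in nhds (0 : ℝ), ∀ k, 0 < x k + t * d k :=
    Filter.eventually_all.2 fun k =>
      (hline k).continuousAt.eventually (lt_mem_nhds (by simpa using hx k))
  have hlocal : IsLocalMin (fun t : ℝ => ∑ k, f k (x k + t * d k)) 0 := by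
    filter_upwards [hpos] with t ht
    simpa using hmin _ ht (by simp [Finset.sum_add_distrib, ← Finset.mul_sum, hd])
  have hzero := hlocal.hasDerivAt_eq_zero hderiv
  simp only [d, Pi.sub_apply, mul_sub, Finset.sum_sub_distrib, Pi.single_apply, mul_ite,
    mul_one, mul_zero, Finset.sum_ite_eq', Finset.mem_univ, if_true] at hzero
  linarith

/-- The derivative of the transmit power of a single device in its transmission time. -/
theorem hasDerivAt_transmit_power {L W μ g t : ℝ} (hW : W ≠ 0) (ht : t ≠ 0) :
    HasDerivAt (fun s : ℝ => ((2 : ℝ) ^ (L / (W * s)) - 1) / (μ * g))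
      (-(L * Real.log 2 / (W * μ)) * ((2 : ℝ) ^ (L / (W * t)) / (t ^ 2 * g))) t := by
  have hexp : HasDerivAt (fun s : ℝ => L / (W * s)) (-(L * W) / (W * t) ^ 2) t := by
    simpa using (hasDerivAt_const t L).fun_div ((hasDerivAt_id t).const_mul W)
      (mul_ne_zero hW ht)
  refine (((hexp.const_rpow (a := 2) two_pos).sub_const 1).div_const (μ * g)).congr_deriv ?_
  field_simp

/-- In power-optimal TDMA with gains `0 < g 0 ≤ … ≤ g (K-1)`, the time allocated to the
weakest device is at most `τs / Σ_j √(g 0 / g j)`. -/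
theorem tdma_power_optimal_weakest_time (K : ℕ) (hK : 0 < K)
    (g : Fin K → ℝ) (hg : ∀ i, 0 < g i) (hmono : Monotone g)
    (L W τs μ : ℝ) (hL : 0 < L) (hW : 0 < W) (hτs : 0 < τs) (hμ : 0 < μ)
    (τStar : Fin K → ℝ) (hτpos : ∀ i, 0 < τStar i) (hτsum : ∑ i, τStar i = τs)
    (hopt : ∀ σ : Fin K → ℝ, (∀ i, 0 < σ i) → ∑ i, σ i = τs →
      ∑ i, ((2 : ℝ) ^ (L / (W * τStar i)) - 1) / (μ * g i) ≤
        ∑ i, ((2 : ℝ) ^ (L / (W * σ i)) - 1) / (μ * g i)) :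
    τStar ⟨0, hK⟩ ≤ τs / ∑ j, Real.sqrt (g ⟨0, hK⟩ / g j) := by
  have hbound : ∀ j, τStar ⟨0, hK⟩ * Real.sqrt (g ⟨0, hK⟩ / g j) ≤ τStar j := by
    intro j
    set o : Fin K := ⟨0, hK⟩
    have hgle : g o ≤ g j := hmono (Nat.zero_le j.1)
    have ho := hτpos o
    have hj := hτpos j
    have hgo := hg o
    have hgj := hg j
    rcases le_total (τStar o) (τStar j) with hle | hle
    · have hsqrt : Real.sqrt (g o / g j) ≤ 1 :=
        Real.sqrt_le_one.2 ((div_le_one hgj).2 hgle)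
      exact (mul_le_of_le_one_right ho.le hsqrt).trans hle
    · have hmarginal := marginal_eq_of_separable_min
        (fun i => hasDerivAt_transmit_power (L := L) (μ := μ) (g := g i) hW.ne' (hτpos i).ne')
        hτpos (fun σ hσ hsum => hopt σ hσ (hsum.trans hτsum)) o j
      have hlog : 0 < Real.log 2 := Real.log_pos one_lt_two
      have hcoef : -(L * Real.log 2 / (W * μ)) ≠ 0 := neg_ne_zero.2 (by positivity)
      have hbal := mul_left_cancel₀ hcoef hmarginal
      have hpow : (2 : ℝ) ^ (L / (W * τStar o)) ≤ (2 : ℝ) ^ (L / (W * τStar j)) :=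
        Real.rpow_le_rpow_of_exponent_le one_le_two (by gcongr)
      have hpowpos : 0 < (2 : ℝ) ^ (L / (W * τStar o)) := by positivity
      rw [div_eq_div_iff (by positivity) (by positivity)] at hbal
      have hsq : τStar o ^ 2 * g o ≤ τStar j ^ 2 * g j := by
        refine le_of_mul_le_mul_left ?_ hpowpos
        rw [hbal]
        gcongr
      refine (sq_le_sq₀ (by positivity) hj.le).1 ?_
      rw [mul_pow, Real.sq_sqrt (by positivity), ← mul_div_assoc, div_le_iff₀ hgj]
      exact hsq
  have hsum : 0 < ∑ j, Real.sqrt (g ⟨0, hK⟩ / g j) :=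
    Finset.sum_pos (fun j _ => Real.sqrt_pos.2 (div_pos (hg _) (hg j))) ⟨⟨0, hK⟩, Finset.mem_univ _⟩
  rw [le_div_iff₀ hsum, Finset.mul_sum, ← hτsum]
  exact Finset.sum_le_sum fun j _ => hbound j
end

section
/- Let K ≥ 1 be an integer, 0 < g_1 ≤ g_2 ≤ … ≤ g_K, and L, W, τ_s, μ > 0. Let τ* = (τ_1*, …, τ_K*) with τ_i* > 0 and Σ_{i=1}^K τ_i* = τ_s minimize the total transmit power P(τ) = Σ_{i=1}^K (2^{L/(W τ_i)} − 1)/(μ g_i) over all such schedules, and let U = Σ_{i=1}^K (2^{K L/(W τ_s)} − 1)/(μ g_i) be the total power of the uniform schedule τ_i = τ_s/K. Then U/P(τ*) ≤ (2^{K L/(W τ_s)} − 1)/(2^{(L/(W τ_s)) Σ_{j=1}^K √(g_1/g_j)} − 1). -/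
/-- Weighted tangent-line inequality for `x ↦ 2 ^ x`: if the weighted mean of `x` is at least `y`,
then the weighted mean of `2 ^ x` is at least `2 ^ y`. -/
theorem sum_mul_two_rpow_sub_one_le {ι : Type*} (s : Finset ι) (w x : ι → ℝ) (y : ℝ)
    (hw : ∀ i ∈ s, 0 ≤ w i) (hy : y * ∑ i ∈ s, w i ≤ ∑ i ∈ s, w i * x i) :
    (∑ i ∈ s, w i) * ((2 : ℝ) ^ y - 1) ≤ ∑ i ∈ s, w i * ((2 : ℝ) ^ x i - 1) := by
  have hlog : 0 < Real.log 2 := Real.log_pos (by norm_num)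
  have tangent (t : ℝ) : (2 : ℝ) ^ y * (1 + Real.log 2 * (t - y)) ≤ (2 : ℝ) ^ t := by
    have h := Real.add_one_le_exp (Real.log 2 * (t - y))
    calc (2 : ℝ) ^ y * (1 + Real.log 2 * (t - y))
        ≤ (2 : ℝ) ^ y * (2 : ℝ) ^ (t - y) := by
          rw [Real.rpow_def_of_pos two_pos (t - y)]
          gcongr
          linarith
      _ = (2 : ℝ) ^ t := by rw [← Real.rpow_add two_pos, add_sub_cancel]
  have hgap : 0 ≤ (2 : ℝ) ^ y * Real.log 2 * (∑ i ∈ s, w i * x i - y * ∑ i ∈ s, w i) :=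
    mul_nonneg (by positivity) (sub_nonneg.2 hy)
  calc (∑ i ∈ s, w i) * ((2 : ℝ) ^ y - 1)
      ≤ (∑ i ∈ s, w i) * ((2 : ℝ) ^ y - 1) +
          (2 : ℝ) ^ y * Real.log 2 * (∑ i ∈ s, w i * x i - y * ∑ i ∈ s, w i) := by linarith
    _ = ∑ i ∈ s, w i * ((2 : ℝ) ^ y * (1 + Real.log 2 * (x i - y)) - 1) := by
        simp only [Finset.sum_mul, Finset.mul_sum, ← Finset.sum_sub_distrib,
          ← Finset.sum_add_distrib]
        exact Finset.sum_congr rfl fun i _ => by ring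
    _ ≤ ∑ i ∈ s, w i * ((2 : ℝ) ^ x i - 1) :=
        Finset.sum_le_sum fun i hi =>
          mul_le_mul_of_nonneg_left (sub_le_sub_right (tangent (x i)) 1) (hw i hi)

/-- Cauchy–Schwarz in Engel form, weakened using `r i ≤ 1`. -/
theorem sum_mul_sum_sq_div_le_sum_sq_div {ι : Type*} (s : Finset ι) (r τ : ι → ℝ)
    (hr : ∀ i ∈ s, 0 ≤ r i) (hr1 : ∀ i ∈ s, r i ≤ 1) (hτ : ∀ i ∈ s, 0 < τ i) :
    (∑ i ∈ s, r i) * (∑ i ∈ s, r i ^ 2) / ∑ i ∈ s, τ i ≤ ∑ i ∈ s, r i ^ 2 / τ i := by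
  refine le_trans ?_ (Finset.sq_sum_div_le_sum_sq_div s r hτ)
  rw [sq (∑ i ∈ s, r i)]
  refine div_le_div_of_nonneg_right (mul_le_mul_of_nonneg_left ?_ (Finset.sum_nonneg hr))
    (Finset.sum_nonneg fun i hi => (hτ i hi).le)
  exact Finset.sum_le_sum fun i hi => pow_le_of_le_one (hr i hi) (hr1 i hi) two_ne_zero


/-- Equal-time vs power-optimal TDMA: the ratio of the total transmit power of the uniform
schedule (`τ_i = τs/K`) to that of the power-optimal schedule is at most
`(2^(K L/(W τs)) - 1) / (2^((L/(W τs)) Σ_j √(g 0/g j)) - 1)`. -/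
theorem tdma_equal_vs_optimal_power (K : ℕ) (hK : 0 < K)
    (g : Fin K → ℝ) (hg : ∀ i, 0 < g i) (hmono : Monotone g)
    (L W τs μ : ℝ) (hL : 0 < L) (hW : 0 < W) (hτs : 0 < τs) (hμ : 0 < μ)
    (τStar : Fin K → ℝ) (hτpos : ∀ i, 0 < τStar i) (hτsum : ∑ i, τStar i = τs)
    (hopt : ∀ σ : Fin K → ℝ, (∀ i, 0 < σ i) → ∑ i, σ i = τs →
      ∑ i, ((2 : ℝ) ^ (L / (W * τStar i)) - 1) / (μ * g i) ≤
        ∑ i, ((2 : ℝ) ^ (L / (W * σ i)) - 1) / (μ * g i)) :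
    (∑ i, ((2 : ℝ) ^ ((K : ℝ) * L / (W * τs)) - 1) / (μ * g i)) /
        (∑ i, ((2 : ℝ) ^ (L / (W * τStar i)) - 1) / (μ * g i)) ≤
      ((2 : ℝ) ^ ((K : ℝ) * L / (W * τs)) - 1) /
        ((2 : ℝ) ^ ((L / (W * τs)) * ∑ j, Real.sqrt (g ⟨0, hK⟩ / g j)) - 1) := by
  set i₀ : Fin K := ⟨0, hK⟩
  have hg₀ : 0 < g i₀ := hg i₀
  set r : Fin K → ℝ := fun j => Real.sqrt (g i₀ / g j) with hr
  have hrpos (j : Fin K) : 0 < r j := Real.sqrt_pos.2 (div_pos hg₀ (hg j))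
  have hr1 (j : Fin K) : r j ≤ 1 := by
    refine Real.sqrt_le_one.2 ((div_le_one (hg j)).2 ?_)
    exact hmono (Fin.mk_le_of_le_val (Nat.zero_le _))
  have hweight (j : Fin K) : 1 / (μ * g j) = r j ^ 2 / (μ * g i₀) := by
    have := (hg j).ne'
    rw [hr, Real.sq_sqrt (div_pos hg₀ (hg j)).le]
    field_simp
  have hmean : L / (W * τs) * (∑ j, r j) * ∑ j, 1 / (μ * g j) ≤
      ∑ j, 1 / (μ * g j) * (L / (W * τStar j)) := by
    have h := sum_mul_sum_sq_div_le_sum_sq_div Finset.univ r τStar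
      (fun j _ => (hrpos j).le) (fun j _ => hr1 j) (fun j _ => hτpos j)
    rw [hτsum] at h
    calc L / (W * τs) * (∑ j, r j) * ∑ j, 1 / (μ * g j)
        = L / (W * (μ * g i₀)) * ((∑ j, r j) * (∑ j, r j ^ 2) / τs) := by
          simp only [hweight, ← Finset.sum_div]
          field_simp
      _ ≤ L / (W * (μ * g i₀)) * ∑ j, r j ^ 2 / τStar j := by gcongr
      _ = ∑ j, 1 / (μ * g j) * (L / (W * τStar j)) := by
          rw [Finset.mul_sum]
          refine Finset.sum_congr rfl fun j _ => ?_
          rw [hweight]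
          have := (hτpos j).ne'
          field_simp
  have hpower := sum_mul_two_rpow_sub_one_le Finset.univ (fun j => 1 / (μ * g j))
    (fun j => L / (W * τStar j)) _ (fun j _ => (one_div_pos.2 (mul_pos hμ (hg j))).le) hmean
  simp only [one_div_mul_eq_div] at hpower
  have hexcess {t : ℝ} (ht : 0 < t) : 0 < (2 : ℝ) ^ t - 1 :=
    sub_pos.2 (Real.one_lt_rpow one_lt_two ht)
  have hrsum : 0 < ∑ j, r j := Finset.sum_pos (fun j _ => hrpos j) ⟨i₀, Finset.mem_univ _⟩
  have hbound : 0 < (2 : ℝ) ^ (L / (W * τs) * ∑ j, r j) - 1 := hexcess (by positivity)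
  have hPpos : 0 < ∑ i, ((2 : ℝ) ^ (L / (W * τStar i)) - 1) / (μ * g i) :=
    Finset.sum_pos (fun i _ => div_pos (hexcess (div_pos hL (mul_pos hW (hτpos i))))
      (mul_pos hμ (hg i))) ⟨i₀, Finset.mem_univ _⟩
  have hU : 0 ≤ (2 : ℝ) ^ ((K : ℝ) * L / (W * τs)) - 1 := (hexcess (by positivity)).le
  rw [div_le_div_iff₀ hPpos hbound]
  simp only [div_eq_mul_one_div (_ - 1 : ℝ) (μ * g _), ← Finset.mul_sum] at hpower ⊢
  rw [mul_assoc]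
  exact mul_le_mul_of_nonneg_left hpower hU
end

section
/- The function Φ(x) = 2^{1/x}·ln 2 − x·(2^{1/x} − 1) is nonnegative and decreasing on (0, ∞). -/
theorem one_le_exp_mul_sq_sub_add_one {t : ℝ} (ht : 0 ≤ t) :
    1 ≤ Real.exp t * (t ^ 2 - t + 1) := by
  have h : (t + 1) * (t ^ 2 - t + 1) ≤ Real.exp t * (t ^ 2 - t + 1) :=
    mul_le_mul_of_nonneg_right (Real.add_one_le_exp t) (by nlinarith [sq_nonneg (t - 1)])
  have h3 : 0 ≤ t ^ 3 := by positivity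
  linarith

theorem exp_div_mul_sub_nonneg (c : ℝ) {x : ℝ} (hx : 0 < x) :
    0 ≤ Real.exp (c / x) * c - x * (Real.exp (c / x) - 1) := by
  have h : Real.exp (c / x) * (1 - c / x) ≤ 1 :=
    calc Real.exp (c / x) * (1 - c / x)
        ≤ Real.exp (c / x) * Real.exp (-(c / x)) := by
          gcongr
          exact Real.one_sub_le_exp_neg _
      _ = 1 := by rw [← Real.exp_add, add_neg_cancel, Real.exp_zero]
  have hc : Real.exp (c / x) * c - x * (Real.exp (c / x) - 1)
      = x * (1 - Real.exp (c / x) * (1 - c / x)) := by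
    field_simp
    ring
  rw [hc]
  exact mul_nonneg hx.le (sub_nonneg.2 h)

theorem hasDerivAt_exp_div_mul_sub (c : ℝ) {x : ℝ} (hx : x ≠ 0) :
    HasDerivAt (fun x : ℝ => Real.exp (c / x) * c - x * (Real.exp (c / x) - 1))
      (1 - Real.exp (c / x) * ((c / x) ^ 2 - c / x + 1)) x := by
  have h : HasDerivAt (fun x : ℝ => Real.exp (c / x))
      (Real.exp (c / x) * (c * -(x ^ 2)⁻¹)) x := by
    simpa only [div_eq_mul_inv] using ((hasDerivAt_inv hx).const_mul c).exp
  refine ((h.mul_const c).sub ((hasDerivAt_id' x).mul (h.sub_const 1))).congr_deriv ?_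
  field_simp
  ring

theorem antitoneOn_exp_div_mul_sub {c : ℝ} (hc : 0 ≤ c) :
    AntitoneOn (fun x : ℝ => Real.exp (c / x) * c - x * (Real.exp (c / x) - 1))
      (Set.Ioi 0) := by
  have hd (x : ℝ) (hx : x ∈ Set.Ioi (0 : ℝ)) :=
    hasDerivAt_exp_div_mul_sub c (ne_of_gt (Set.mem_Ioi.1 hx))
  refine antitoneOn_of_deriv_nonpos (convex_Ioi 0)
    (fun x hx => (hd x hx).continuousAt.continuousWithinAt)
    (fun x hx => (hd x (interior_subset hx)).differentiableAt.differentiableWithinAt)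
    fun x hx => ?_
  have hx : x ∈ Set.Ioi (0 : ℝ) := interior_subset hx
  rw [(hd x hx).deriv]
  exact sub_nonpos.2 (one_le_exp_mul_sq_sub_add_one (div_nonneg hc (Set.mem_Ioi.1 hx).le))

/-- The function `Φ(x) = 2^(1/x) ln 2 - x (2^(1/x) - 1)` is nonnegative and decreasing
on `(0, ∞)`. -/
theorem Phi_nonneg_and_antitone :
    (∀ x ∈ Set.Ioi (0 : ℝ),
        0 ≤ (2 : ℝ) ^ (1 / x) * Real.log 2 - x * ((2 : ℝ) ^ (1 / x) - 1)) ∧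
    AntitoneOn (fun x : ℝ => (2 : ℝ) ^ (1 / x) * Real.log 2 - x * ((2 : ℝ) ^ (1 / x) - 1))
      (Set.Ioi 0) := by
  have h (x : ℝ) : (2 : ℝ) ^ (1 / x) = Real.exp (Real.log 2 / x) := by
    rw [Real.rpow_def_of_pos two_pos, mul_one_div]
  simp only [h]
  exact ⟨fun x hx => exp_div_mul_sub_nonneg _ hx,
    antitoneOn_exp_div_mul_sub (Real.log_nonneg one_le_two)⟩
end

section
/- Let a > 0, 0 < g₁ ≤ g_i, and τ₁, τ_i > 0, and define D(x) = 2^{a/x}·(a/x)·ln 2 + 1 − 2^{a/x}. If D(τ₁)/g₁ = D(τ_i)/g_i, then τ₁ ≥ τ_i and g₁/g_i ≤ τ_i/τ₁. -/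
open Real in
/-- The function `x ↦ x eˣ + 1 - eˣ` is positive away from zero. -/
lemma mul_exp_add_one_sub_exp_pos {x : ℝ} (hx : x ≠ 0) : 0 < x * exp x + 1 - exp x := by
  have h := add_one_lt_exp (neg_ne_zero.mpr hx)
  have h' : exp (-x) * exp x = 1 := by rw [← exp_add]; simp
  nlinarith [exp_pos x]

open Real in
/-- The quotient `(x eˣ + 1 - eˣ) / x` is monotone on the positive reals. -/
lemma mul_exp_add_one_sub_exp_div_le {x y : ℝ} (hx : 0 < x) (hxy : x ≤ y) :
    (x * exp x + 1 - exp x) / x ≤ (y * exp y + 1 - exp y) / y := by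
  obtain ⟨d, hd, rfl⟩ : ∃ d, 0 ≤ d ∧ y = x + d := ⟨y - x, by linarith, by ring⟩
  have hpos : 0 ≤ d * exp d + 1 - exp d := by
    rcases hd.eq_or_lt with rfl | hd
    · simp
    · exact (mul_exp_add_one_sub_exp_pos hd.ne').le
  have tangent : x * exp x + 1 - exp x + x * exp x * d ≤
      (x + d) * exp (x + d) + 1 - exp (x + d) := by
    have h : 0 ≤ exp x * (x * (exp d - 1 - d) + (d * exp d + 1 - exp d)) :=
      mul_nonneg (exp_pos x).le
        (add_nonneg (mul_nonneg hx.le (by linarith [add_one_le_exp d])) hpos)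
    rw [exp_add]
    linarith
  have origin : x * exp x + 1 - exp x ≤ x ^ 2 * exp x := by
    have h : (x + 1) * (x ^ 2 - x + 1) ≤ exp x * (x ^ 2 - x + 1) :=
      mul_le_mul_of_nonneg_right (add_one_le_exp x) (by nlinarith [sq_nonneg (x - 1)])
    have : 0 < x ^ 3 := by positivity
    linarith
  rw [div_le_div_iff₀ hx (by linarith)]
  linarith [mul_le_mul_of_nonneg_left tangent hx.le, mul_le_mul_of_nonneg_left origin hd]


/-- First-order optimality condition for the energy-optimal TDMA schedule: with
`D(x) = 2^(a/x) (a/x) ln 2 + 1 - 2^(a/x)`, if `D(τ₁)/g₁ = D(τᵢ)/gᵢ` with `0 < g₁ ≤ gᵢ`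
and `τ₁, τᵢ > 0`, then `τ₁ ≥ τᵢ` and `g₁/gᵢ ≤ τᵢ/τ₁`. -/
theorem tdma_energy_optimality_condition (a g₁ gi τ₁ τi : ℝ)
    (ha : 0 < a) (hg₁ : 0 < g₁) (hg : g₁ ≤ gi) (hτ₁ : 0 < τ₁) (hτi : 0 < τi)
    (heq : ((2 : ℝ) ^ (a / τ₁) * (a / τ₁) * Real.log 2 + 1 - (2 : ℝ) ^ (a / τ₁)) / g₁ =
           ((2 : ℝ) ^ (a / τi) * (a / τi) * Real.log 2 + 1 - (2 : ℝ) ^ (a / τi)) / gi) :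
    τi ≤ τ₁ ∧ g₁ / gi ≤ τi / τ₁ := by
  set u := Real.log 2 * (a / τ₁) with hu
  set v := Real.log 2 * (a / τi) with hv
  have hlog : 0 < Real.log 2 := Real.log_pos one_lt_two
  have hu0 : 0 < u := by positivity
  have hv0 : 0 < v := by positivity
  have hgi : 0 < gi := hg₁.trans_le hg
  have hposu := mul_exp_add_one_sub_exp_pos hu0.ne'
  have hposv := mul_exp_add_one_sub_exp_pos hv0.ne'
  have hratio : u / v = τi / τ₁ := by
    rw [hu, hv]
    field_simp
  rw [Real.rpow_def_of_pos two_pos, Real.rpow_def_of_pos two_pos, ← hu, ← hv,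
    show Real.exp u * (a / τ₁) * Real.log 2 = u * Real.exp u by rw [hu]; ring,
    show Real.exp v * (a / τi) * Real.log 2 = v * Real.exp v by rw [hv]; ring,
    div_eq_div_iff hg₁.ne' hgi.ne'] at heq
  generalize hH : u * Real.exp u + 1 - Real.exp u = H at heq hposu
  generalize hK : v * Real.exp v + 1 - Real.exp v = K at heq hposv
  have hHK : H ≤ K := by
    refine le_of_mul_le_mul_right ?_ hgi
    rw [heq]
    exact mul_le_mul_of_nonneg_left hg hposv.le
  have huv : u ≤ v := by
    by_contra! hlt
    have h := mul_exp_add_one_sub_exp_div_le hv0 hlt.le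
    rw [hH, hK, div_le_div_iff₀ hv0 hu0] at h
    nlinarith
  constructor
  · rw [← div_le_one hτ₁, ← hratio]
    exact (div_le_one hv0).mpr huv
  · have h := mul_exp_add_one_sub_exp_div_le hu0 huv
    rw [hH, hK, div_le_div_iff₀ hu0 hv0] at h
    have hg_ratio : g₁ / gi = H / K := by
      rw [div_eq_div_iff hgi.ne' hposv.ne']
      linarith
    rw [← hratio, hg_ratio, div_le_div_iff₀ hposv hv0]
    linarith
end

section
/- Let K ≥ 1 be an integer, 0 < g_1 ≤ g_2 ≤ … ≤ g_K, and L, W, τ_s, μ > 0. If τ* = (τ_1*, …, τ_K*) with τ_i* > 0 and Σ_{i=1}^K τ_i* = τ_s minimizes the total energy per bit E(τ) = Σ_{i=1}^K (τ_i/L)(2^{L/(W τ_i)} − 1)/(μ g_i) over all such schedules, then τ_1* ≤ τ_s / (Σ_{i=1}^K g_1/g_i). -/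
open Real in
/-- The function `x ↦ x eˣ - eˣ + 1` is positive on `(0, ∞)`. -/
lemma mul_exp_sub_exp_add_one_pos {x : ℝ} (hx : 0 < x) : 0 < x * exp x - exp x + 1 := by
  have h : -x + 1 < exp (-x) := add_one_lt_exp (by linarith)
  have hmul : exp (-x) * exp x = 1 := by rw [← exp_add]; simp
  nlinarith [mul_lt_mul_of_pos_right h (exp_pos x)]

open Real in
/-- Tangent-line inequality for the convex function `x ↦ x eˣ - eˣ + 1` on `(0, ∞)`. -/
lemma mul_exp_sub_exp_add_one_tangent {x y : ℝ} (hx : 0 < x) (hxy : x < y) :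
    (x * exp x - exp x + 1) + x * exp x * (y - x) ≤ y * exp y - exp y + 1 := by
  obtain ⟨d, rfl⟩ : ∃ d, y = x + d := ⟨y - x, by ring⟩
  have hd : 0 < d := by linarith
  have h₁ := mul_nonneg hx.le (sub_nonneg.2 (add_one_le_exp d))
  have h₂ := mul_exp_sub_exp_add_one_pos hd
  have h := mul_nonneg (exp_pos x).le (add_nonneg h₁ h₂.le)
  rw [exp_add]
  linarith

open Real in
/-- The ratio `(x eˣ - eˣ + 1) / x` is nondecreasing on `(0, ∞)`. -/
lemma mul_exp_sub_exp_add_one_ratio_le {x y : ℝ} (hx : 0 < x) (hxy : x < y) :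
    y * (x * exp x - exp x + 1) ≤ x * (y * exp y - exp y + 1) := by
  have ht := mul_le_mul_of_nonneg_left (mul_exp_sub_exp_add_one_tangent hx hxy) hx.le
  have hq : 0 ≤ x ^ 2 * exp x - (x * exp x - exp x + 1) := by
    have h₁ := add_one_le_exp x
    have h₂ : 0 ≤ x ^ 2 - x + 1 := by nlinarith [sq_nonneg (x - 1)]
    nlinarith [mul_le_mul_of_nonneg_left h₁ h₂, pow_pos hx 3]
  nlinarith [mul_nonneg (sub_nonneg.2 hxy.le) hq]

open Real in
lemma le_mul_of_mul_exp_sub_exp_add_one_eq {x y r : ℝ} (hx : 0 < x) (hr : 1 ≤ r)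
    (h : y * exp y - exp y + 1 = r * (x * exp x - exp x + 1)) : y ≤ r * x := by
  by_contra! hlt
  have hxy : x < y := by nlinarith
  have hle := mul_exp_sub_exp_add_one_ratio_le hx hxy
  rw [h] at hle
  nlinarith [mul_pos (sub_pos.2 hlt) (mul_exp_sub_exp_add_one_pos hx)]

open Real in
/-- Derivative of the energy per bit with respect to the transmission time. -/
lemma hasDerivAt_tdma_energy {L W t : ℝ} (hL : L ≠ 0) (hW : W ≠ 0) (ht : t ≠ 0) (c : ℝ) :
    HasDerivAt (fun s : ℝ => (s / L) * ((2 : ℝ) ^ (L / (W * s)) - 1) / c)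
      (-((L * log 2 / (W * t)) * exp (L * log 2 / (W * t))
        - exp (L * log 2 / (W * t)) + 1) / (L * c)) t := by
  have h₂ : ∀ z : ℝ, (2 : ℝ) ^ z = exp (log 2 * z) := fun z => rpow_def_of_pos (by norm_num) z
  simp only [h₂]
  have hWs : HasDerivAt (fun s : ℝ => W * s) W t := by simpa using (hasDerivAt_id t).const_mul W
  have hq := (((hasDerivAt_const t L).div hWs (mul_ne_zero hW ht)).const_mul (log 2)).exp
  have h := ((((hasDerivAt_id t).div_const L).mul (hq.sub_const 1))).div_const c
  refine h.congr_deriv ?_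
  have he : log 2 * (L / (W * t)) = L * log 2 / (W * t) := by ring
  simp only [Pi.div_apply, id, he]
  generalize exp (L * log 2 / (W * t)) = e
  field_simp
  ring

/-- At an interior minimizer of a separable function under a sum constraint, all partial
derivatives agree. -/
lemma deriv_eq_of_isMin_sum {ι : Type*} [Fintype ι] [DecidableEq ι]
    {f : ι → ℝ → ℝ} {f' τ : ι → ℝ} (hτ : ∀ i, 0 < τ i)
    (hf : ∀ i, HasDerivAt (f i) (f' i) (τ i))
    (hmin : ∀ σ : ι → ℝ, (∀ i, 0 < σ i) → ∑ i, σ i = ∑ i, τ i →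
      ∑ i, f i (τ i) ≤ ∑ i, f i (σ i)) (i j : ι) : f' i = f' j := by
  set d : ι → ℝ := Pi.single i 1 - Pi.single j 1 with hd
  have hline : ∀ k, HasDerivAt (fun s : ℝ => τ k + s * d k) (d k) 0 := fun k => by
    simpa using ((hasDerivAt_id (0 : ℝ)).mul_const (d k)).const_add (τ k)
  have hderiv : HasDerivAt (fun s : ℝ => ∑ k, f k (τ k + s * d k)) (∑ k, f' k * d k) 0 := by
    refine HasDerivAt.fun_sum fun k _ => ?_
    have hk : HasDerivAt (f k) (f' k) (τ k + 0 * d k) := by simpa using hf k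
    exact hk.comp (0 : ℝ) (hline k)
  have hloc : IsLocalMin (fun s : ℝ => ∑ k, f k (τ k + s * d k)) 0 := by
    have hpos : ∀ᶠ s in nhds (0 : ℝ), ∀ k, 0 < τ k + s * d k :=
      Filter.eventually_all.2 fun k =>
        (hline k).continuousAt.eventually (lt_mem_nhds (by simpa using hτ k))
    filter_upwards [hpos] with s hs
    simpa using hmin _ hs (by
      simp [Finset.sum_add_distrib, ← Finset.mul_sum, hd, Finset.sum_sub_distrib])
  have hzero := hloc.hasDerivAt_eq_zero hderiv
  simp only [hd, Pi.sub_apply, mul_sub, Finset.sum_sub_distrib, Pi.single_apply, mul_ite, mul_one,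
    mul_zero, Finset.sum_ite_eq', Finset.mem_univ, if_true] at hzero
  linarith


/-- In energy-optimal TDMA with gains `0 < g 0 ≤ … ≤ g (K-1)`, the time allocated to the
weakest device is at most `τs / Σ_i (g 0 / g i)`. -/
theorem tdma_energy_optimal_weakest_time (K : ℕ) (hK : 0 < K)
    (g : Fin K → ℝ) (hg : ∀ i, 0 < g i) (hmono : Monotone g)
    (L W τs μ : ℝ) (hL : 0 < L) (hW : 0 < W) (hτs : 0 < τs) (hμ : 0 < μ)
    (τStar : Fin K → ℝ) (hτpos : ∀ i, 0 < τStar i) (hτsum : ∑ i, τStar i = τs)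
    (hopt : ∀ σ : Fin K → ℝ, (∀ i, 0 < σ i) → ∑ i, σ i = τs →
      ∑ i, (τStar i / L) * ((2 : ℝ) ^ (L / (W * τStar i)) - 1) / (μ * g i) ≤
        ∑ i, (σ i / L) * ((2 : ℝ) ^ (L / (W * σ i)) - 1) / (μ * g i)) :
    τStar ⟨0, hK⟩ ≤ τs / ∑ i, g ⟨0, hK⟩ / g i := by
  have hKKT := deriv_eq_of_isMin_sum hτpos
    (fun i => hasDerivAt_tdma_energy hL.ne' hW.ne' (hτpos i).ne' (μ * g i))
    (by simpa only [hτsum] using hopt)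
  set o : Fin K := ⟨0, hK⟩
  have hratio : ∀ i, τStar o * (g o / g i) ≤ τStar i := fun i => by
    have hgo := hg o
    have hgi := hg i
    have hτo := hτpos o
    have hτi := hτpos i
    have hlog : 0 < Real.log 2 := Real.log_pos (by norm_num)
    have hr : 1 ≤ g i / g o := (one_le_div hgo).2 (hmono (Fin.mk_le_of_le_val (Nat.zero_le _)))
    have hx : 0 < L * Real.log 2 / (W * τStar o) := by positivity
    have hle := le_mul_of_mul_exp_sub_exp_add_one_eq (y := L * Real.log 2 / (W * τStar i)) hx hr (by
      have h := hKKT i o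
      rw [div_eq_div_iff (by positivity) (by positivity)] at h
      rw [div_mul_eq_mul_div (g i), eq_div_iff hgo.ne']
      apply mul_left_cancel₀ (mul_pos hL hμ).ne'
      linarith)
    rw [div_mul_div_comm, div_le_div_iff₀ (by positivity) (by positivity)] at hle
    rw [mul_div_assoc', div_le_iff₀ hgi]
    have hc : 0 < L * Real.log 2 * W := by positivity
    refine le_of_mul_le_mul_left ?_ hc
    linarith
  have hsum : 0 < ∑ i, g o / g i :=
    Finset.sum_pos (fun i _ => div_pos (hg o) (hg i)) ⟨o, Finset.mem_univ o⟩
  rw [le_div_iff₀ hsum, Finset.mul_sum, ← hτsum]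
  exact Finset.sum_le_sum fun i _ => hratio i
end

section
/- Let K ≥ 1 be an integer, 0 < g_1 ≤ g_2 ≤ … ≤ g_K, and L, W, τ_s, μ > 0. Let τ* = (τ_1*, …, τ_K*) with τ_i* > 0 and Σ_{i=1}^K τ_i* = τ_s minimize the total energy per bit E(τ) = Σ_{i=1}^K (τ_i/L)(2^{L/(W τ_i)} − 1)/(μ g_i) over all such schedules, and let U = Σ_{i=1}^K (τ_s/(K L))(2^{K L/(W τ_s)} − 1)/(μ g_i) be the total energy per bit of the uniform schedule τ_i = τ_s/K. Then U/E(τ*) ≤ ((Σ_{i=1}^K g_1/g_i)/K) · (2^{K L/(W τ_s)} − 1)/(2^{(L/(W τ_s)) Σ_{i=1}^K g_1/g_i} − 1). -/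
/-- A convex function `x ↦ 2 ^ x - 1` vanishing at `0` is star-shaped. -/
lemma two_rpow_mul_sub_one_le {r : ℝ} (hr0 : 0 ≤ r) (hr1 : r ≤ 1) (x : ℝ) :
    (2 : ℝ) ^ (r * x) - 1 ≤ r * ((2 : ℝ) ^ x - 1) := by
  have h := (convexOn_rpow_left (b := 2) two_pos).2 (Set.mem_univ x) (Set.mem_univ 0)
    hr0 (sub_nonneg.2 hr1) (by ring)
  simp only [smul_eq_mul, mul_zero, add_zero, Real.rpow_zero, mul_one] at h
  linarith

/-- Jensen's inequality for `x ↦ 2 ^ x - 1` in perspective form. -/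
lemma mul_two_rpow_sum_div_sub_one_le {ι : Type*} (s : Finset ι) (t a : ι → ℝ) {T : ℝ}
    (ht : ∀ i ∈ s, 0 < t i) (hT : 0 < T) (hsum : ∑ i ∈ s, t i = T) :
    T * ((2 : ℝ) ^ ((∑ i ∈ s, a i) / T) - 1) ≤
      ∑ i ∈ s, t i * ((2 : ℝ) ^ (a i / t i) - 1) := by
  have h := (convexOn_rpow_left (b := 2) two_pos).map_sum_le (t := s)
    (w := fun i => t i / T) (p := fun i => a i / t i)
    (fun i hi => (div_pos (ht i hi) hT).le)
    (by rw [← Finset.sum_div, hsum, div_self hT.ne']) (fun i _ => Set.mem_univ _)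
  have e : ∑ i ∈ s, (t i / T) • (a i / t i) = (∑ i ∈ s, a i) / T := by
    rw [Finset.sum_div]
    refine Finset.sum_congr rfl fun i hi => ?_
    have := (ht i hi).ne'
    simp only [smul_eq_mul]
    field_simp
  rw [e] at h
  simp only [smul_eq_mul, div_mul_eq_mul_div, ← Finset.sum_div] at h
  rw [le_div_iff₀ hT] at h
  simp only [mul_sub, mul_one, Finset.sum_sub_distrib, hsum]
  linarith

/-- Lower bound on the energy per bit of an arbitrary TDMA schedule. -/
lemma tdma_energy_lower_bound {ι : Type*} [Fintype ι] (g : ι → ℝ) (hg : ∀ i, 0 < g i)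
    {γ : ℝ} (hγ : 0 < γ) (hγg : ∀ i, γ ≤ g i)
    {L W T μ : ℝ} (hL : 0 < L) (hW : 0 < W) (hT : 0 < T) (hμ : 0 < μ)
    (τ : ι → ℝ) (hτ : ∀ i, 0 < τ i) (hsum : ∑ i, τ i = T) :
    T * ((2 : ℝ) ^ ((L / (W * T)) * ∑ i, γ / g i) - 1) / (L * μ * γ) ≤
      ∑ i, (τ i / L) * ((2 : ℝ) ^ (L / (W * τ i)) - 1) / (μ * g i) := by
  have h := mul_two_rpow_sum_div_sub_one_le Finset.univ τ (fun i => L / W * (γ / g i))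
    (fun i _ => hτ i) hT hsum
  have e : (∑ i, L / W * (γ / g i)) / T = (L / (W * T)) * ∑ i, γ / g i := by
    rw [← Finset.mul_sum]
    field_simp
  rw [e] at h
  rw [div_le_iff₀ (by positivity)]
  refine h.trans ?_
  rw [Finset.sum_mul]
  refine Finset.sum_le_sum fun i _ => ?_
  have hgi := hg i
  have hti := hτ i
  have hb := two_rpow_mul_sub_one_le (r := γ / g i) (by positivity)
    ((div_le_one hgi).2 (hγg i)) (L / (W * τ i))
  have e₁ : L / W * (γ / g i) / τ i = γ / g i * (L / (W * τ i)) := by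
    field_simp
  have e₂ : (τ i / L) * ((2 : ℝ) ^ (L / (W * τ i)) - 1) / (μ * g i) * (L * μ * γ) =
      τ i * (γ / g i * ((2 : ℝ) ^ (L / (W * τ i)) - 1)) := by
    generalize (2 : ℝ) ^ (L / (W * τ i)) = y
    field_simp
  rw [e₁, e₂]
  exact mul_le_mul_of_nonneg_left hb hti.le

/-- Equal-time vs energy-optimal TDMA: the ratio of the total energy per bit of the uniform
schedule (`τ_i = τs/K`) to that of the energy-optimal schedule is at most
`((Σ_i g 0/g i)/K) (2^(K L/(W τs)) - 1)/(2^((L/(W τs)) Σ_i g 0/g i) - 1)`. -/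
theorem tdma_equal_vs_optimal_energy (K : ℕ) (hK : 0 < K)
    (g : Fin K → ℝ) (hg : ∀ i, 0 < g i) (hmono : Monotone g)
    (L W τs μ : ℝ) (hL : 0 < L) (hW : 0 < W) (hτs : 0 < τs) (hμ : 0 < μ)
    (τStar : Fin K → ℝ) (hτpos : ∀ i, 0 < τStar i) (hτsum : ∑ i, τStar i = τs)
    (hopt : ∀ σ : Fin K → ℝ, (∀ i, 0 < σ i) → ∑ i, σ i = τs →
      ∑ i, (τStar i / L) * ((2 : ℝ) ^ (L / (W * τStar i)) - 1) / (μ * g i) ≤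
        ∑ i, (σ i / L) * ((2 : ℝ) ^ (L / (W * σ i)) - 1) / (μ * g i)) :
    (∑ i, (τs / ((K : ℝ) * L)) * ((2 : ℝ) ^ ((K : ℝ) * L / (W * τs)) - 1) / (μ * g i)) /
        (∑ i, (τStar i / L) * ((2 : ℝ) ^ (L / (W * τStar i)) - 1) / (μ * g i)) ≤
      ((∑ i, g ⟨0, hK⟩ / g i) / (K : ℝ)) *
        (((2 : ℝ) ^ ((K : ℝ) * L / (W * τs)) - 1) /
          ((2 : ℝ) ^ ((L / (W * τs)) * ∑ i, g ⟨0, hK⟩ / g i) - 1)) := by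
  have hγ := hg ⟨0, hK⟩
  have hγg : ∀ i, g ⟨0, hK⟩ ≤ g i := fun i => hmono (Nat.zero_le i.1)
  have hE := tdma_energy_lower_bound g hg hγ hγg hL hW hτs hμ τStar hτpos hτsum
  have hKpos : (0 : ℝ) < K := Nat.cast_pos.2 hK
  have hS : 0 < ∑ i, g ⟨0, hK⟩ / g i :=
    Finset.sum_pos (fun i _ => div_pos hγ (hg i)) ⟨⟨0, hK⟩, Finset.mem_univ _⟩
  have hA : 0 < (2 : ℝ) ^ ((K : ℝ) * L / (W * τs)) - 1 :=
    sub_pos.2 (Real.one_lt_rpow one_lt_two (by positivity))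
  have hB : 0 < (2 : ℝ) ^ ((L / (W * τs)) * ∑ i, g ⟨0, hK⟩ / g i) - 1 :=
    sub_pos.2 (Real.one_lt_rpow one_lt_two (by positivity))
  have hU : ∑ i, (τs / ((K : ℝ) * L)) * ((2 : ℝ) ^ ((K : ℝ) * L / (W * τs)) - 1) / (μ * g i) =
      τs / (K * L) * ((2 : ℝ) ^ ((K : ℝ) * L / (W * τs)) - 1) / (μ * g ⟨0, hK⟩) *
        ∑ i, g ⟨0, hK⟩ / g i := by
    rw [Finset.mul_sum]
    refine Finset.sum_congr rfl fun i _ => ?_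
    have := hg i
    generalize (2 : ℝ) ^ ((K : ℝ) * L / (W * τs)) = y
    field_simp
  rw [hU]
  generalize (2 : ℝ) ^ ((K : ℝ) * L / (W * τs)) - 1 = A at *
  generalize (2 : ℝ) ^ ((L / (W * τs)) * ∑ i, g ⟨0, hK⟩ / g i) - 1 = B at *
  generalize ∑ i, g ⟨0, hK⟩ / g i = S at *
  refine (div_le_div_of_nonneg_left (by positivity) (by positivity) hE).trans_eq ?_
  field_simp
end

section
/- Let K ≥ 1 be an integer, L > 0, and 0 < S ≤ K a real number. Then the limit as x → ∞ of (S/K) · (2^{K L/x} − 1)/(2^{S L/x} − 1) equals 1. Consequently, since the ratio of the uniform-schedule energy to the optimal-schedule energy in TDMA lies between 1 and this bound with x = W τ_s and S = Σ_{i=1}^K g_1/g_i, equal time allocation is sum-energy optimal over TDMA schedules in the limit of asymptotically low spectral efficiency W τ_s → ∞. -/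
open Filter

/-- The first-order expansion of `2 ^ (a / x)` for large `x`. -/
theorem tendsto_mul_two_rpow_div_sub_one (a : ℝ) :
    Tendsto (fun x : ℝ => x * ((2 : ℝ) ^ (a / x) - 1)) atTop (nhds (a * Real.log 2)) := by
  have hd : HasDerivAt (fun y : ℝ => (2 : ℝ) ^ (a * y)) (a * Real.log 2) 0 := by
    have h := ((hasDerivAt_id (0 : ℝ)).const_mul a).const_rpow (a := 2) (by norm_num)
    simpa [mul_comm] using h
  have h1 := hd.tendsto_slope_zero_right.comp tendsto_inv_atTop_nhdsGT_zero
  refine h1.congr fun x => ?_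
  simp [div_eq_mul_inv]

/-- The energy per bit of a slot of length `τ` is bounded below by its wideband limit. -/
theorem log_two_div_le_slot_energy {L W τ : ℝ} (hL : 0 < L) (hW : 0 < W) (hτ : 0 < τ) :
    Real.log 2 / W ≤ (τ / L) * ((2 : ℝ) ^ (L / (W * τ)) - 1) := by
  have h : Real.log 2 * (L / (W * τ)) ≤ (2 : ℝ) ^ (L / (W * τ)) - 1 := by
    rw [Real.rpow_def_of_pos (by norm_num)]
    linarith [Real.add_one_le_exp (Real.log 2 * (L / (W * τ)))]
  calc Real.log 2 / W = (τ / L) * (Real.log 2 * (L / (W * τ))) := by field_simp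
    _ ≤ _ := by gcongr

/-- For `0 < S ≤ K` and `L > 0`, `(S/K)(2^(K L/x) - 1)/(2^(S L/x) - 1) → 1` as `x → ∞`.
Consequently (since the uniform-to-optimal energy ratio in TDMA lies between `1` and this
bound with `x = W τs` and `S = Σ_i g 0/g i`), equal time allocation is sum-energy optimal
over TDMA schedules in the limit of asymptotically low spectral efficiency `W τs → ∞`. -/
theorem tdma_equal_energy_asymptotically_optimal (K : ℕ) (hK : 1 ≤ K)
    (L : ℝ) (hL : 0 < L) (S : ℝ) (hS0 : 0 < S) (hSK : S ≤ (K : ℝ)) :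
    Tendsto (fun x : ℝ =>
        (S / (K : ℝ)) * ((2 : ℝ) ^ ((K : ℝ) * L / x) - 1) / ((2 : ℝ) ^ (S * L / x) - 1))
      atTop (nhds 1) ∧
    ∀ g : Fin K → ℝ, (∀ i, 0 < g i) → Monotone g →
      ∀ ε > (0 : ℝ), ∃ X : ℝ, ∀ W τs μ : ℝ, 0 < W → 0 < τs → 0 < μ → X ≤ W * τs →
        ∀ τStar : Fin K → ℝ, (∀ i, 0 < τStar i) → (∑ i, τStar i = τs) →
          (∀ σ : Fin K → ℝ, (∀ i, 0 < σ i) → ∑ i, σ i = τs →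
            ∑ i, (τStar i / L) * ((2 : ℝ) ^ (L / (W * τStar i)) - 1) / (μ * g i) ≤
              ∑ i, (σ i / L) * ((2 : ℝ) ^ (L / (W * σ i)) - 1) / (μ * g i)) →
          1 ≤ (∑ i, (τs / ((K : ℝ) * L)) * ((2 : ℝ) ^ ((K : ℝ) * L / (W * τs)) - 1) / (μ * g i)) /
                (∑ i, (τStar i / L) * ((2 : ℝ) ^ (L / (W * τStar i)) - 1) / (μ * g i)) ∧
          (∑ i, (τs / ((K : ℝ) * L)) * ((2 : ℝ) ^ ((K : ℝ) * L / (W * τs)) - 1) / (μ * g i)) /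
                (∑ i, (τStar i / L) * ((2 : ℝ) ^ (L / (W * τStar i)) - 1) / (μ * g i)) ≤ 1 + ε := by
  have hK0 : (0 : ℝ) < K := by exact_mod_cast hK
  have hlog : 0 < Real.log 2 := Real.log_pos (by norm_num)
  constructor
  · have h := ((tendsto_mul_two_rpow_div_sub_one (K * L)).const_mul (S / K)).div
      (tendsto_mul_two_rpow_div_sub_one (S * L)) (by positivity)
    have hlim : S / K * (K * L * Real.log 2) / (S * L * Real.log 2) = 1 := by field_simp
    rw [hlim] at h
    refine h.congr' ?_
    filter_upwards [eventually_gt_atTop 0] with x hx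
    rw [Pi.div_apply, mul_left_comm, mul_div_mul_left _ _ hx.ne']
  · intro g hg _ ε hε
    have h := (tendsto_mul_two_rpow_div_sub_one (K * L)).div_const (K * L * Real.log 2)
    rw [div_self (by positivity)] at h
    obtain ⟨X, hX⟩ := eventually_atTop.1 (h.eventually_le_const (by linarith : 1 < 1 + ε))
    refine ⟨X, fun W τs μ hW hτs hμ hXW τ hτ _ hopt => ?_⟩
    have hne : (Finset.univ : Finset (Fin K)).Nonempty := ⟨⟨0, hK⟩, Finset.mem_univ _⟩
    have hweight : 0 < ∑ i, 1 / (μ * g i) :=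
      Finset.sum_pos (fun i _ => by have := hg i; positivity) hne
    have hlower : Real.log 2 / W * ∑ i, 1 / (μ * g i) ≤
        ∑ i, (τ i / L) * ((2 : ℝ) ^ (L / (W * τ i)) - 1) / (μ * g i) := by
      rw [Finset.mul_sum]
      refine Finset.sum_le_sum fun i _ => ?_
      have := hg i
      rw [mul_one_div]
      gcongr
      exact log_two_div_le_slot_energy hL hW (hτ i)
    have hpos : 0 < ∑ i, (τ i / L) * ((2 : ℝ) ^ (L / (W * τ i)) - 1) / (μ * g i) :=
      lt_of_lt_of_le (by positivity) hlower
    constructor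
    · rw [one_le_div hpos]
      refine (hopt (fun _ => τs / K) (fun _ => by positivity) ?_).trans_eq ?_
      · simp [mul_div_cancel₀ _ hK0.ne']
      · have hexp : L / (W * (τs / K)) = K * L / (W * τs) := by field_simp
        simp only [hexp, div_div]
    · rw [div_le_iff₀ hpos]
      have hfactor : τs / (K * L) * ((2 : ℝ) ^ (K * L / (W * τs)) - 1) ≤
          (1 + ε) * (Real.log 2 / W) := by
        calc _ = W * τs * ((2 : ℝ) ^ (K * L / (W * τs)) - 1) / (K * L * Real.log 2) *
              (Real.log 2 / W) := by field_simp
          _ ≤ _ := by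
            gcongr
            exact hX _ hXW
      calc _ = τs / (K * L) * ((2 : ℝ) ^ (K * L / (W * τs)) - 1) * ∑ i, 1 / (μ * g i) := by
            simp only [Finset.mul_sum, mul_one_div]
        _ ≤ (1 + ε) * (Real.log 2 / W) * ∑ i, 1 / (μ * g i) := by gcongr
        _ = (1 + ε) * (Real.log 2 / W * ∑ i, 1 / (μ * g i)) := by ring
        _ ≤ _ := by gcongr
end

section
/- Let K ≥ 1 be an integer, 0 < g_1 ≤ g_2 ≤ … ≤ g_K, and L, W, τ_s, μ > 0. If W* = (W_1*, …, W_K*) with W_i* > 0 and Σ_{i=1}^K W_i* = W minimizes the total transmit power P(W_1, …, W_K) = Σ_{i=1}^K (W_i/W)(2^{L/(W_i τ_s)} − 1)/(μ g_i) over all such allocations, then W_1* ≤ W / (Σ_{i=1}^K g_1/g_i). -/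
/-- The function `x ↦ 1 + (x - 1) eˣ` is convex on the nonnegative half-line. -/
theorem convexOn_one_add_sub_one_mul_exp :
    ConvexOn ℝ (Set.Ici 0) fun x : ℝ => 1 + (x - 1) * Real.exp x := by
  have hd : ∀ x : ℝ, HasDerivAt (fun x : ℝ => 1 + (x - 1) * Real.exp x) (x * Real.exp x) x := by
    intro x
    have h := (((hasDerivAt_id x).sub_const 1).mul (Real.hasDerivAt_exp x)).const_add 1
    refine h.congr_deriv ?_
    simp only [id]
    ring
  refine MonotoneOn.convexOn_of_deriv (convex_Ici 0) (by fun_prop) (by fun_prop) ?_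
  intro x hx y hy hxy
  rw [interior_Ici, Set.mem_Ioi] at hx hy
  rw [(hd x).deriv, (hd y).deriv]
  gcongr

/-- If `1 + (y - 1) eʸ` is `b / a` times `1 + (x - 1) eˣ`, then `y` is at most `b / a` times `x`. -/
theorem mul_le_mul_of_one_add_sub_one_mul_exp {a b x y : ℝ} (ha : 0 < a) (hab : a ≤ b)
    (hx : 0 < x)
    (h : a * (1 + (y - 1) * Real.exp y) = b * (1 + (x - 1) * Real.exp x)) :
    a * y ≤ b * x := by
  by_contra! hlt
  have hxy : x < y := by nlinarith
  have hy : 0 < y := hx.trans hxy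
  have hpos : 0 < 1 + (x - 1) * Real.exp x := by
    have h1 := Real.add_one_lt_exp (neg_ne_zero.mpr hx.ne')
    have h2 : Real.exp (-x) * Real.exp x = 1 := by rw [← Real.exp_add]; simp
    nlinarith [Real.exp_pos x]
  have hconv := convexOn_one_add_sub_one_mul_exp.2 (Set.mem_Ici.mpr hy.le)
    (Set.mem_Ici.mpr le_rfl) (div_nonneg hx.le hy.le)
    (sub_nonneg.mpr ((div_le_one hy).mpr hxy.le)) (add_sub_cancel (x / y) 1)
  simp only [smul_eq_mul, mul_zero, add_zero, div_mul_cancel₀ x hy.ne', zero_sub,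
    Real.exp_zero, mul_one, add_neg_cancel] at hconv
  rw [div_mul_eq_mul_div, le_div_iff₀ hy] at hconv
  nlinarith

/-- Derivative of the energy cost `w (2 ^ (L / (w τ)) - 1)` in the bandwidth `w`. -/
theorem hasDerivAt_mul_two_rpow_div_sub_one (L τ : ℝ) {w : ℝ} (hτ : τ ≠ 0) (hw : w ≠ 0) :
    HasDerivAt (fun w : ℝ => w * ((2 : ℝ) ^ (L / (w * τ)) - 1))
      (-(1 + (Real.log 2 * (L / (w * τ)) - 1) * Real.exp (Real.log 2 * (L / (w * τ))))) w := by
  simp only [Real.rpow_def_of_pos (two_pos : (0 : ℝ) < 2)]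
  have h1 := ((hasDerivAt_const w L).fun_div ((hasDerivAt_id' w).mul_const τ)
    (mul_ne_zero hw hτ)).const_mul (Real.log 2)
  refine ((hasDerivAt_id' w).fun_mul (h1.exp.sub_const 1)).congr_deriv ?_
  field_simp
  ring

/-- Lagrange condition for a separable sum: at a minimizer over positive vectors of given total,
all partial derivatives agree. -/
theorem deriv_eq_of_sum_le_of_sum_eq {ι : Type*} [Fintype ι] {f : ι → ℝ → ℝ} {f' w : ι → ℝ}
    (hw : ∀ i, 0 < w i) (hf : ∀ i, HasDerivAt (f i) (f' i) (w i))
    (hopt : ∀ v : ι → ℝ, (∀ i, 0 < v i) → ∑ i, v i = ∑ i, w i →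
      ∑ i, f i (w i) ≤ ∑ i, f i (v i)) (i j : ι) :
    f' i = f' j := by
  classical
  let d : ι → ℝ := Pi.single i 1 - Pi.single j 1
  have hline : ∀ k, HasDerivAt (fun t : ℝ => w k + t * d k) (d k) 0 := fun k => by
    simpa using ((hasDerivAt_id' (0 : ℝ)).mul_const (d k)).const_add (w k)
  have hderiv : HasDerivAt (fun t : ℝ => ∑ k, f k (w k + t * d k)) (∑ k, f' k * d k) 0 := by
    refine HasDerivAt.fun_sum fun k _ => ?_
    refine HasDerivAt.comp (h₂ := f k) (0 : ℝ) ?_ (hline k)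
    simpa using hf k
  have hmin : IsLocalMin (fun t : ℝ => ∑ k, f k (w k + t * d k)) 0 := by
    have hpos : ∀ᶠ t in nhds (0 : ℝ), ∀ k, 0 < w k + t * d k :=
      Filter.eventually_all.mpr fun k =>
        (hline k).continuousAt.eventually_const_lt (by simpa using hw k)
    filter_upwards [hpos] with t ht
    simpa using hopt _ ht (by simp [d, Finset.sum_add_distrib, ← Finset.mul_sum])
  have h0 := hmin.hasDerivAt_eq_zero hderiv
  simp only [d, Pi.sub_apply, mul_sub, Finset.sum_sub_distrib, Pi.single_apply, mul_ite, mul_one,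
    mul_zero, Finset.sum_ite_eq', Finset.mem_univ, if_true] at h0
  linarith


/-- In power-optimal FDMA with gains `0 < g 0 ≤ … ≤ g (K-1)`, the bandwidth allocated to
the weakest device is at most `W / Σ_i (g 0 / g i)`. -/
theorem fdma_power_optimal_weakest_bandwidth (K : ℕ) (hK : 0 < K)
    (g : Fin K → ℝ) (hg : ∀ i, 0 < g i) (hmono : Monotone g)
    (L W τs μ : ℝ) (hL : 0 < L) (hW : 0 < W) (hτs : 0 < τs) (hμ : 0 < μ)
    (WStar : Fin K → ℝ) (hWpos : ∀ i, 0 < WStar i) (hWsum : ∑ i, WStar i = W)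
    (hopt : ∀ ω : Fin K → ℝ, (∀ i, 0 < ω i) → ∑ i, ω i = W →
      ∑ i, (WStar i / W) * ((2 : ℝ) ^ (L / (WStar i * τs)) - 1) / (μ * g i) ≤
        ∑ i, (ω i / W) * ((2 : ℝ) ^ (L / (ω i * τs)) - 1) / (μ * g i)) :
    WStar ⟨0, hK⟩ ≤ W / ∑ i, g ⟨0, hK⟩ / g i := by
  set z : Fin K := ⟨0, hK⟩
  have hlog : 0 < Real.log 2 := Real.log_pos one_lt_two
  have hstat := deriv_eq_of_sum_le_of_sum_eq
    (f := fun i w => (w / W) * ((2 : ℝ) ^ (L / (w * τs)) - 1) / (μ * g i)) hWpos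
    (fun i => (((hasDerivAt_mul_two_rpow_div_sub_one L τs hτs.ne'
      (hWpos i).ne').div_const W).div_const (μ * g i)).congr_of_eventuallyEq
        (.of_forall fun w => by ring))
    (fun v hv hsum => hopt v hv (hsum.trans hWsum)) z
  have hle : ∀ i, WStar z * (g z / g i) ≤ WStar i := fun i => by
    have hi := hWpos i
    have hz := hWpos z
    have hgi := hg i
    have hgz := hg z
    have hkey := hstat i
    rw [div_div, div_div, div_eq_div_iff (by positivity) (by positivity)] at hkey
    have hWμ : W * μ ≠ 0 := by positivity
    have h := mul_le_mul_of_one_add_sub_one_mul_exp (y := Real.log 2 * (L / (WStar i * τs)))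
      (x := Real.log 2 * (L / (WStar z * τs))) hgz
      (hmono (show z ≤ i from Nat.zero_le i.val)) (by positivity)
      (mul_left_cancel₀ hWμ (by linear_combination hkey))
    have e : ∀ a w : ℝ, a * (Real.log 2 * (L / (w * τs))) = (Real.log 2 * L / τs) * (a / w) :=
      fun a w => by ring
    rw [e, e, mul_le_mul_iff_right₀ (by positivity), div_le_div_iff₀ hi hz] at h
    rw [← mul_div_assoc, div_le_iff₀ hgi]
    linarith
  have hsum : 0 < ∑ i, g z / g i :=
    Finset.sum_pos (fun i _ => div_pos (hg z) (hg i)) ⟨z, Finset.mem_univ z⟩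
  rw [le_div_iff₀ hsum, Finset.mul_sum, ← hWsum]
  exact Finset.sum_le_sum fun i _ => hle i
end

section
/- Let K ≥ 1 be an integer, 0 < g_1 ≤ g_2 ≤ … ≤ g_K, and L, W, τ_s, μ > 0. Let W* = (W_1*, …, W_K*) with W_i* > 0 and Σ_{i=1}^K W_i* = W minimize the total transmit power P(W_1, …, W_K) = Σ_{i=1}^K (W_i/W)(2^{L/(W_i τ_s)} − 1)/(μ g_i) over all such allocations, and let U = Σ_{i=1}^K (1/K)(2^{K L/(W τ_s)} − 1)/(μ g_i) be the total power of the equal-bandwidth allocation W_i = W/K. Then U/P(W*) ≤ ((Σ_{i=1}^K g_1/g_i)/K) · (2^{K L/(W τ_s)} − 1)/(2^{(L/(W τ_s)) Σ_{i=1}^K g_1/g_i} − 1), and the same bound holds for the ratio of total energies per bit. -/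
/-- Jensen's inequality for `x ↦ 2 ^ x - 1` with weights `w i`, followed by the fact that this
convex function vanishes at `0`, so that scaling its argument by `a i ≤ 1` costs a factor `a i`. -/
theorem two_rpow_mul_sum_sub_one_le {ι : Type*} (s : Finset ι) (a w : ι → ℝ) (c : ℝ)
    (ha : ∀ i ∈ s, 0 ≤ a i) (ha' : ∀ i ∈ s, a i ≤ 1) (hw : ∀ i ∈ s, 0 < w i)
    (hsum : ∑ i ∈ s, w i = 1) :
    (2 : ℝ) ^ (c * ∑ i ∈ s, a i) - 1 ≤ ∑ i ∈ s, a i * (w i * ((2 : ℝ) ^ (c / w i) - 1)) := by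
  have hjensen := (convexOn_rpow_left (b := 2) two_pos).map_sum_le (t := s) (w := w)
    (p := fun i => c / w i * a i) (fun i hi => (hw i hi).le) hsum (fun _ _ => Set.mem_univ _)
  simp only [smul_eq_mul] at hjensen
  have hmean : ∑ i ∈ s, w i * (c / w i * a i) = c * ∑ i ∈ s, a i := by
    rw [Finset.mul_sum]
    refine Finset.sum_congr rfl fun i hi => ?_
    have := (hw i hi).ne'
    field_simp
  rw [hmean] at hjensen
  have hscale : ∑ i ∈ s, w i * (2 : ℝ) ^ (c / w i * a i) ≤
      ∑ i ∈ s, (w i + a i * (w i * ((2 : ℝ) ^ (c / w i) - 1))) := by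
    refine Finset.sum_le_sum fun i hi => ?_
    have hpow : (0 : ℝ) ≤ 2 ^ (c / w i) := by positivity
    have hbern := rpow_one_add_le_one_add_mul_self
      (s := (2 : ℝ) ^ (c / w i) - 1) (by linarith) (ha i hi) (ha' i hi)
    rw [add_sub_cancel, ← Real.rpow_mul two_pos.le] at hbern
    calc w i * (2 : ℝ) ^ (c / w i * a i)
        ≤ w i * (1 + a i * ((2 : ℝ) ^ (c / w i) - 1)) :=
          mul_le_mul_of_nonneg_left hbern (hw i hi).le
      _ = _ := by ring
  rw [Finset.sum_add_distrib, hsum] at hscale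
  linarith

/-- Equal-bandwidth vs optimal FDMA: the ratio of the total transmit power of the
equal-bandwidth allocation (`W_i = W/K`) to that of the power-optimal allocation is at most
`((Σ_i g 0/g i)/K) (2^(K L/(W τs)) - 1)/(2^((L/(W τs)) Σ_i g 0/g i) - 1)`, and the same
bound holds for the ratio of total energies per bit (energy per bit = `(τs/L) ×` power). -/
theorem fdma_equal_vs_optimal (K : ℕ) (hK : 0 < K)
    (g : Fin K → ℝ) (hg : ∀ i, 0 < g i) (hmono : Monotone g)
    (L W τs μ : ℝ) (hL : 0 < L) (hW : 0 < W) (hτs : 0 < τs) (hμ : 0 < μ)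
    (WStar : Fin K → ℝ) (hWpos : ∀ i, 0 < WStar i) (hWsum : ∑ i, WStar i = W)
    (hopt : ∀ ω : Fin K → ℝ, (∀ i, 0 < ω i) → ∑ i, ω i = W →
      ∑ i, (WStar i / W) * ((2 : ℝ) ^ (L / (WStar i * τs)) - 1) / (μ * g i) ≤
        ∑ i, (ω i / W) * ((2 : ℝ) ^ (L / (ω i * τs)) - 1) / (μ * g i)) :
    (∑ i, (1 / (K : ℝ)) * ((2 : ℝ) ^ ((K : ℝ) * L / (W * τs)) - 1) / (μ * g i)) /
        (∑ i, (WStar i / W) * ((2 : ℝ) ^ (L / (WStar i * τs)) - 1) / (μ * g i)) ≤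
      ((∑ i, g ⟨0, hK⟩ / g i) / (K : ℝ)) *
        (((2 : ℝ) ^ ((K : ℝ) * L / (W * τs)) - 1) /
          ((2 : ℝ) ^ ((L / (W * τs)) * ∑ i, g ⟨0, hK⟩ / g i) - 1)) ∧
    ((τs / L) * ∑ i, (1 / (K : ℝ)) * ((2 : ℝ) ^ ((K : ℝ) * L / (W * τs)) - 1) / (μ * g i)) /
        ((τs / L) * ∑ i, (WStar i / W) * ((2 : ℝ) ^ (L / (WStar i * τs)) - 1) / (μ * g i)) ≤
      ((∑ i, g ⟨0, hK⟩ / g i) / (K : ℝ)) *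
        (((2 : ℝ) ^ ((K : ℝ) * L / (W * τs)) - 1) /
          ((2 : ℝ) ^ ((L / (W * τs)) * ∑ i, g ⟨0, hK⟩ / g i) - 1)) := by
  have hg0 := hg ⟨0, hK⟩
  have hK' : (0 : ℝ) < K := by exact_mod_cast hK
  have hstar_ge : ((2 : ℝ) ^ ((L / (W * τs)) * ∑ i, g ⟨0, hK⟩ / g i) - 1) / (μ * g ⟨0, hK⟩) ≤
      ∑ i, (WStar i / W) * ((2 : ℝ) ^ (L / (WStar i * τs)) - 1) / (μ * g i) := by
    have hle := two_rpow_mul_sum_sub_one_le Finset.univ (fun i => g ⟨0, hK⟩ / g i)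
      (fun i => WStar i / W) (L / (W * τs))
      (fun i _ => (div_pos hg0 (hg i)).le)
      (fun i _ => (div_le_one (hg i)).2 (hmono (Nat.zero_le i.val)))
      (fun i _ => div_pos (hWpos i) hW)
      (by rw [← Finset.sum_div, hWsum, div_self hW.ne'])
    rw [div_le_iff₀ (by positivity), Finset.sum_mul]
    refine hle.trans_eq (Finset.sum_congr rfl fun i _ => ?_)
    have hWi := hWpos i
    have hgi := hg i
    have hexp : L / (W * τs) / (WStar i / W) = L / (WStar i * τs) := by field_simp
    rw [hexp]
    field_simp
  have hs : 0 < ∑ i, g ⟨0, hK⟩ / g i :=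
    Finset.sum_pos (fun i _ => div_pos hg0 (hg i)) ⟨⟨0, hK⟩, Finset.mem_univ _⟩
  have hbase : 0 < (2 : ℝ) ^ ((L / (W * τs)) * ∑ i, g ⟨0, hK⟩ / g i) - 1 :=
    sub_pos.2 (Real.one_lt_rpow one_lt_two (by positivity))
  have hequal : 0 < (2 : ℝ) ^ ((K : ℝ) * L / (W * τs)) - 1 :=
    sub_pos.2 (Real.one_lt_rpow one_lt_two (by positivity))
  have hU : ∑ i, (1 / (K : ℝ)) * ((2 : ℝ) ^ ((K : ℝ) * L / (W * τs)) - 1) / (μ * g i) =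
      ((∑ i, g ⟨0, hK⟩ / g i) / (K : ℝ)) * ((2 : ℝ) ^ ((K : ℝ) * L / (W * τs)) - 1) /
        (μ * g ⟨0, hK⟩) := by
    rw [Finset.sum_div, Finset.sum_mul, Finset.sum_div]
    refine Finset.sum_congr rfl fun i _ => ?_
    have hgi := hg i
    field_simp
  rw [mul_div_mul_left _ _ (div_pos hτs hL).ne', and_self, hU]
  refine (div_le_div_of_nonneg_left (by positivity) (by positivity) hstar_ge).trans_eq ?_
  rw [div_div_div_cancel_right₀ (by positivity), mul_div_assoc]
end

section
/- Let K ≥ 1 be an integer, g_1, …, g_K > 0, and L > 0. Define, for x > 0, R(x) = (1/K) · (2^{L K/x} − 1)/(2^{L/x} − 1) · (Σ_{k=1}^K 1/g_k)/(Σ_{k=1}^K 2^{(k−1)L/x}/g_k). Then the limit of R(x) as x → ∞ equals 1. Consequently, equal-bandwidth FDMA is sum-power optimal over the space of general (not necessarily orthogonal) resource allocation strategies in the limit of asymptotically low spectral efficiency W τ_s → ∞. -/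
open Filter

theorem tendsto_two_rpow_div_atTop (a : ℝ) :
    Tendsto (fun x : ℝ => (2 : ℝ) ^ (a / x)) atTop (nhds 1) := by
  simpa using (tendsto_const_nhds (x := (2 : ℝ))).rpow
    ((tendsto_const_nhds (x := a)).div_atTop tendsto_id) (Or.inl two_ne_zero)

theorem two_rpow_sub_one_div_eq_geom_sum (K : ℕ) {L x : ℝ} (hL : 0 < L) (hx : 0 < x) :
    ((2 : ℝ) ^ (L * (K : ℝ) / x) - 1) / ((2 : ℝ) ^ (L / x) - 1) =
      ∑ i ∈ Finset.range K, ((2 : ℝ) ^ (L / x)) ^ i := by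
  rw [geom_sum_eq (Real.one_lt_rpow one_lt_two (div_pos hL hx)).ne', ← Real.rpow_natCast,
    ← Real.rpow_mul zero_le_two, div_mul_eq_mul_div]

theorem tendsto_two_rpow_sub_one_div (K : ℕ) {L : ℝ} (hL : 0 < L) :
    Tendsto (fun x : ℝ => ((2 : ℝ) ^ (L * (K : ℝ) / x) - 1) / ((2 : ℝ) ^ (L / x) - 1))
      atTop (nhds K) := by
  have h : Tendsto (fun x : ℝ => ∑ i ∈ Finset.range K, ((2 : ℝ) ^ (L / x)) ^ i)
      atTop (nhds K) := by
    simpa using tendsto_finsetSum (Finset.range K)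
      fun i _ => (tendsto_two_rpow_div_atTop L).pow i
  refine h.congr' ?_
  filter_upwards [eventually_gt_atTop 0] with x hx
  exact (two_rpow_sub_one_div_eq_geom_sum K hL hx).symm

theorem tendsto_sum_two_rpow_div {K : ℕ} (g : Fin K → ℝ) (L : ℝ) :
    Tendsto (fun x : ℝ => ∑ k : Fin K, (2 : ℝ) ^ ((k : ℝ) * L / x) / g k)
      atTop (nhds (∑ k, 1 / g k)) :=
  tendsto_finsetSum _ fun k _ => (tendsto_two_rpow_div_atTop ((k : ℝ) * L)).div_const (g k)

/-- `R(x) = (1/K) (2^(LK/x) - 1)/(2^(L/x) - 1) · (Σ_k 1/g_k)/(Σ_k 2^(k L/x)/g_k) → 1` as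
`x → ∞` (users indexed `0,…,K-1`).  Consequently, since the ratio of the equal-bandwidth
FDMA total power `U` to the global-minimum (SIC) total power `P` is `U/P = R(W τs)`,
equal-bandwidth FDMA is sum-power optimal over general resource allocation strategies in the
limit of asymptotically low spectral efficiency `W τs → ∞`. -/
theorem fdma_equal_bandwidth_asymptotically_sum_power_optimal (K : ℕ) (hK : 1 ≤ K)
    (g : Fin K → ℝ) (hg : ∀ k, 0 < g k) (L : ℝ) (hL : 0 < L) :
    Tendsto (fun x : ℝ =>
        (1 / (K : ℝ)) * (((2 : ℝ) ^ (L * (K : ℝ) / x) - 1) / ((2 : ℝ) ^ (L / x) - 1)) *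
          ((∑ k, 1 / g k) / (∑ k : Fin K, (2 : ℝ) ^ ((k : ℝ) * L / x) / g k)))
      atTop (nhds 1) ∧
    ∀ μ : ℝ, 0 < μ →
      Tendsto (fun x : ℝ =>
          ((1 / (K : ℝ)) * ((2 : ℝ) ^ ((K : ℝ) * L / x) - 1) / μ * ∑ k, 1 / g k) /
            ((((2 : ℝ) ^ (L / x) - 1) / μ) * ∑ k : Fin K, (2 : ℝ) ^ ((k : ℝ) * L / x) / g k))
        atTop (nhds 1) := by
  have hK0 : (K : ℝ) ≠ 0 := by exact_mod_cast (Nat.one_le_iff_ne_zero.mp hK)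
  have hS : (∑ k, 1 / g k) ≠ 0 :=
    (Finset.sum_pos (fun k _ => one_div_pos.mpr (hg k)) ⟨⟨0, hK⟩, Finset.mem_univ _⟩).ne'
  have hR : Tendsto (fun x : ℝ =>
      (1 / (K : ℝ)) * (((2 : ℝ) ^ (L * (K : ℝ) / x) - 1) / ((2 : ℝ) ^ (L / x) - 1)) *
        ((∑ k, 1 / g k) / (∑ k : Fin K, (2 : ℝ) ^ ((k : ℝ) * L / x) / g k)))
      atTop (nhds 1) := by
    have h := ((tendsto_two_rpow_sub_one_div K hL).const_mul (1 / (K : ℝ))).mul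
      ((tendsto_const_nhds (x := ∑ k, 1 / g k)).div (tendsto_sum_two_rpow_div g L) hS)
    rwa [one_div_mul_cancel hK0, div_self hS, one_mul] at h
  refine ⟨hR, fun μ hμ => hR.congr fun x => ?_⟩
  rw [mul_comm L (K : ℝ), mul_div_mul_comm, div_div_div_cancel_right₀ hμ.ne',
    mul_div_assoc (1 / (K : ℝ))]
end
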